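/- Let K ⊆ E be measurable and u : E × X → ℝ a bounded measurable process with u(x,ξ) = 0 whenever x ∉ K. Assume that for every m ≤ n, ∫ ξ(K)^m μ(dξ) < ∞ and ∫ (∫_K c(z,ξ) λ(dz))^m μ(dξ) < ∞, and likewise all iterated integrals on the right-hand side below are finite. Define the compensated integral ∫ u dν (ξ) = ∫ u(y,ξ) ξ(dy) − ∫ u(y,ξ) c(y,ξ) λ(dy). Then for every bounded measurable F : X → ℝ: ∫ F(ξ) (∫ u dν (ξ))^n μ(dξ) = ∑_{i=0}^n (−1)^i binom(n,i) ∑_{k=1}^{n−i} ∑_{𝒫 = {P_1,…,P_k} ∈ 𝒯_{n−i}^k} ∫_X ∫_{E^k} ĉ((x_1,…,x_k), ξ) F(ξ+Δ) ∏_{l=1}^k u(x_l, ξ+Δ)^{|P_l|} (∫ u(z, ξ+Δ) c(z, ξ+Δ) λ(dz))^i λ(dx_1)⋯λ(dx_k) μ(dξ), where Δ = δ_{x_1}+⋯+δ_{x_k}, with the convention that the i = n term is (−1)^n ∫ F(ξ) (∫ u(z,ξ) c(z,ξ) λ(dz))^n μ(dξ). -/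

import Mathlib

open MeasureTheory Finset

/-- The compound Papangelou intensity along a tuple:
`ĉ((x_1,…,x_k), ξ) = ∏_{l=1}^k c(x_l, ξ + δ_{x_1} + ⋯ + δ_{x_{l−1}})`. -/
noncomputable def chat {E : Type*} [MeasurableSpace E] (c : E → Measure E → ENNReal)
    {k : ℕ} (x : Fin k → E) (ξ : Measure E) : ENNReal :=
  ∏ l : Fin k, c (x l) (ξ + ∑ j ∈ Finset.univ.filter (fun j => j < l), Measure.dirac (x j))

/-- A fixed enumeration of the blocks of a partition of `{1,…,n}`. -/
noncomputable def blockOf {n : ℕ} (P : Finpartition (Finset.univ : Finset (Fin n)))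
    (l : Fin P.parts.card) : Finset (Fin n) := (P.parts.equivFin.symm l : { B // B ∈ P.parts })

/-- The compensated integral `∫ u dν(ξ) = ∫ u(y,ξ) ξ(dy) − ∫ u(y,ξ) c(y,ξ) λ(dy)`. -/
noncomputable def compInt {E : Type*} [MeasurableSpace E] (lam : Measure E)
    (c : E → Measure E → ENNReal) (u : E → Measure E → ℝ) (ξ : Measure E) : ℝ :=
  (∫ y, u y ξ ∂ξ) - ∫ y, u y ξ * (c y ξ).toReal ∂lam

namespace Finpartition

variable {α : Type*} [DecidableEq α] {s : Finset α} {a : α}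

/-- Insert the new element `a` into the block `B` of `Q`, where `B = ∅` stands for opening a new
block. -/
def insertInto (Q : Finpartition s) (ha : a ∉ s) (B : Finset α) (hB : B ∈ insert ∅ Q.parts) :
    Finpartition (insert a s) :=
  ofExistsUnique (insert (insert a B) (Q.parts.erase B))
    (by
      have hBs : B ⊆ s := by
        rcases Finset.mem_insert.1 hB with rfl | h
        · simp
        · exact Q.subset h
      intro p hp
      rcases Finset.mem_insert.1 hp with rfl | h
      · exact Finset.insert_subset_insert _ hBs
      · exact (Q.subset (Finset.mem_of_mem_erase h)).trans (Finset.subset_insert _ _))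
    (by
      have hBs : B ⊆ s := by
        rcases Finset.mem_insert.1 hB with rfl | h
        · simp
        · exact Q.subset h
      intro x hx
      by_cases hxB : x ∈ insert a B
      · refine ⟨insert a B, ⟨by simp, hxB⟩, ?_⟩
        rintro t ⟨ht, hxt⟩
        rcases Finset.mem_insert.1 ht with rfl | h
        · rfl
        · exfalso
          have htQ := Finset.mem_of_mem_erase h
          rcases Finset.mem_insert.1 hxB with rfl | hxB
          · exact ha (Q.subset htQ hxt)
          · rcases Finset.mem_insert.1 hB with rfl | h'
            · simp at hxB
            · exact Finset.ne_of_mem_erase h (Q.eq_of_mem_parts htQ h' hxt hxB)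
      · have hxs : x ∈ s := by
          rcases Finset.mem_insert.1 hx with rfl | h
          · simp at hxB
          · exact h
        obtain ⟨t, ⟨ht, hxt⟩, hu⟩ := Q.existsUnique_mem hxs
        refine ⟨t, ⟨?_, hxt⟩, ?_⟩
        · refine Finset.mem_insert_of_mem (Finset.mem_erase.2 ⟨?_, ht⟩)
          rintro rfl
          exact hxB (Finset.mem_insert_of_mem hxt)
        · rintro t' ⟨ht', hxt'⟩
          rcases Finset.mem_insert.1 ht' with rfl | h
          · exact absurd hxt' hxB
          · exact hu t' ⟨Finset.mem_of_mem_erase h, hxt'⟩)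
    (by
      intro h
      rcases Finset.mem_insert.1 h with h | h
      · exact Finset.insert_ne_empty _ _ h.symm
      · exact Q.empty_notMem_parts (Finset.mem_of_mem_erase h))

/-- Remove the element `a` from its block. -/
def removeElem (P : Finpartition (insert a s)) (ha : a ∉ s) : Finpartition s :=
  ofExistsUnique ((insert ((P.part a).erase a) (P.parts.erase (P.part a))).erase ∅)
    (by
      intro p hp
      have hpart : P.part a ⊆ insert a s := P.part_subset a
      rcases Finset.mem_insert.1 (Finset.mem_of_mem_erase hp) with rfl | h
      · intro x hx
        have := hpart (Finset.mem_of_mem_erase hx)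
        exact Finset.mem_of_mem_insert_of_ne this (Finset.ne_of_mem_erase hx)
      · intro x hx
        have h' := Finset.mem_erase.1 h
        refine Finset.mem_of_mem_insert_of_ne (P.subset h'.2 hx) ?_
        rintro rfl
        exact h'.1 (P.part_eq_of_mem h'.2 hx).symm)
    (by
      intro x hx
      have hxa : x ≠ a := by rintro rfl; exact ha hx
      have hpa : P.part a ∈ P.parts := P.part_mem.2 (by simp)
      obtain ⟨t, ⟨ht, hxt⟩, hu⟩ := P.existsUnique_mem (Finset.mem_insert_of_mem (b := a) hx)
      by_cases hta : t = P.part a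
      · subst hta
        have hx' : x ∈ (P.part a).erase a := Finset.mem_erase.2 ⟨hxa, hxt⟩
        refine ⟨(P.part a).erase a, ⟨?_, hx'⟩, ?_⟩
        · exact Finset.mem_erase.2 ⟨Finset.ne_empty_of_mem hx', by simp⟩
        · rintro t ⟨h, hxt'⟩
          rcases Finset.mem_insert.1 (Finset.mem_of_mem_erase h) with rfl | h
          · rfl
          · exact absurd (hu t ⟨Finset.mem_of_mem_erase h, hxt'⟩) (Finset.ne_of_mem_erase h)
      · refine ⟨t, ⟨Finset.mem_erase.2 ⟨Finset.ne_empty_of_mem hxt, ?_⟩, hxt⟩, ?_⟩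
        · exact Finset.mem_insert_of_mem (Finset.mem_erase.2 ⟨hta, ht⟩)
        · rintro t' ⟨h, hxt'⟩
          rcases Finset.mem_insert.1 (Finset.mem_of_mem_erase h) with rfl | h
          · exact absurd (hu _ ⟨hpa, Finset.mem_of_mem_erase hxt'⟩).symm hta
          · exact hu t' ⟨Finset.mem_of_mem_erase h, hxt'⟩)
    (by simp)

theorem parts_insertInto (Q : Finpartition s) (ha : a ∉ s) (B : Finset α)
    (hB : B ∈ insert ∅ Q.parts) :
    (Q.insertInto ha B hB).parts = insert (insert a B) (Q.parts.erase B) := rfl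

theorem parts_removeElem (P : Finpartition (insert a s)) (ha : a ∉ s) :
    (P.removeElem ha).parts
      = (insert ((P.part a).erase a) (P.parts.erase (P.part a))).erase ∅ := rfl

theorem part_insertInto (Q : Finpartition s) (ha : a ∉ s) (B : Finset α)
    (hB : B ∈ insert ∅ Q.parts) : (Q.insertInto ha B hB).part a = insert a B :=
  part_eq_of_mem _ (by simp [parts_insertInto]) (by simp)

theorem notMem_of_mem_insert_parts (Q : Finpartition s) (ha : a ∉ s) {B : Finset α}
    (hB : B ∈ insert ∅ Q.parts) : a ∉ B := by
  rcases Finset.mem_insert.1 hB with rfl | h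
  · simp
  · exact fun h' => ha (Q.subset h h')

theorem insert_notMem_erase_parts (Q : Finpartition s) (ha : a ∉ s) (B : Finset α) :
    insert a B ∉ Q.parts.erase B :=
  fun h => ha (Q.subset (Finset.mem_of_mem_erase h) (Finset.mem_insert_self _ _))

theorem removeElem_insertInto (Q : Finpartition s) (ha : a ∉ s) (B : Finset α)
    (hB : B ∈ insert ∅ Q.parts) : (Q.insertInto ha B hB).removeElem ha = Q := by
  ext1
  rw [parts_removeElem, part_insertInto, parts_insertInto,
    Finset.erase_insert (Q.notMem_of_mem_insert_parts ha hB),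
    Finset.erase_insert (Q.insert_notMem_erase_parts ha B)]
  rcases Finset.mem_insert.1 hB with rfl | h
  · simp [Q.empty_notMem_parts]
  · rw [Finset.insert_erase h, Finset.erase_eq_of_notMem Q.empty_notMem_parts]

theorem erase_part_mem (P : Finpartition (insert a s)) (ha : a ∉ s) :
    (P.part a).erase a ∈ insert ∅ (P.removeElem ha).parts := by
  rw [parts_removeElem]
  by_cases h : (P.part a).erase a = ∅
  · simp [h]
  · exact Finset.mem_insert_of_mem (Finset.mem_erase.2 ⟨h, by simp⟩)

theorem insertInto_removeElem (P : Finpartition (insert a s)) (ha : a ∉ s) :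
    (P.removeElem ha).insertInto ha ((P.part a).erase a) (P.erase_part_mem ha) = P := by
  have hpa : P.part a ∈ P.parts := P.part_mem.2 (by simp)
  have haa : a ∈ P.part a := P.mem_part_self.2 (by simp)
  have h2 : (P.part a).erase a ∉ P.parts.erase (P.part a) := by
    intro h
    obtain ⟨x, hx⟩ := P.nonempty_of_mem_parts (Finset.mem_of_mem_erase h)
    exact Finset.ne_of_mem_erase h
      (P.eq_of_mem_parts (Finset.mem_of_mem_erase h) hpa hx (Finset.mem_of_mem_erase hx))
  have h3 : (∅ : Finset α) ∉ P.parts.erase (P.part a) :=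
    fun h => P.empty_notMem_parts (Finset.mem_of_mem_erase h)
  ext1
  rw [parts_insertInto, parts_removeElem, Finset.insert_erase haa, Finset.erase_right_comm,
    Finset.erase_insert h2, Finset.erase_eq_of_notMem h3, Finset.insert_erase hpa]

/-- Summing over the partitions of `insert a s` a function of the block sizes: either `a` is a
block of its own, or it is added to a block of a partition of `s`. -/
theorem sum_insert_blockSizes {M : Type*} [AddCommMonoid M] (ha : a ∉ s)
    (Φ : Multiset ℕ → M) :
    ∑ P : Finpartition (insert a s), Φ (P.parts.val.map card)
      = ∑ Q : Finpartition s, (Φ (1 ::ₘ Q.parts.val.map card)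
          + ((Q.parts.val.map card).map
              fun b => Φ ((b + 1) ::ₘ (Q.parts.val.map card).erase b)).sum) := by
  have hval : ∀ (Q : Finpartition s) (B : Finset α) (hB : B ∈ insert ∅ Q.parts),
      (Q.insertInto ha B hB).parts.val.map card
        = (#B + 1) ::ₘ (Q.parts.erase B).val.map card := by
    intro Q B hB
    rw [parts_insertInto, Finset.insert_val_of_notMem (Q.insert_notMem_erase_parts ha B),
      Multiset.map_cons, Finset.card_insert_of_notMem (Q.notMem_of_mem_insert_parts ha hB)]
  have hsum : ∀ Q : Finpartition s, Φ (1 ::ₘ Q.parts.val.map card)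
          + ((Q.parts.val.map card).map
              fun b => Φ ((b + 1) ::ₘ (Q.parts.val.map card).erase b)).sum
      = ∑ B ∈ insert ∅ Q.parts, Φ ((#B + 1) ::ₘ (Q.parts.erase B).val.map card) := by
    intro Q
    rw [Finset.sum_insert Q.empty_notMem_parts, Multiset.map_map]
    congr 1
    · simp [Q.empty_notMem_parts]
    · refine Finset.sum_congr rfl fun B hB => ?_
      simp only [Function.comp_apply, Finset.erase_val]
      rw [Multiset.map_erase_of_mem _ _ hB]
  simp_rw [hsum]
  rw [Finset.sum_sigma' Finset.univ (fun Q : Finpartition s => insert ∅ Q.parts)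
    (fun Q B => Φ ((#B + 1) ::ₘ (Q.parts.erase B).val.map card))]
  symm
  refine Finset.sum_bij' (fun x hx => x.1.insertInto ha x.2 (Finset.mem_sigma.1 hx).2)
    (fun P _ => ⟨P.removeElem ha, (P.part a).erase a⟩) (by simp) ?_ ?_ ?_ ?_
  · intro P _
    exact Finset.mem_sigma.2 ⟨Finset.mem_univ _, P.erase_part_mem ha⟩
  · rintro ⟨Q, B⟩ hx
    have hB := (Finset.mem_sigma.1 hx).2
    simp only [part_insertInto, removeElem_insertInto,
      Finset.erase_insert (Q.notMem_of_mem_insert_parts ha hB)]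
  · intro P _
    exact P.insertInto_removeElem ha
  · rintro ⟨Q, B⟩ hx
    rw [hval]

end Finpartition

namespace Papangelou

/-- An abstract form of the recursion satisfied by the moments of a factorial Campbell measure:
`J H a` is the moment of `H` with exponents `a`, `S H p` is the product of `H` with the integral of
the `p`-th power of the process and `B H k` says that the moments of `H` of order `k` are finite. -/
structure IsMomentSystem {α R : Type*} [AddCommGroup R] (B : α → ℕ → Prop) (S : α → ℕ → α)
    (J : α → ∀ {k : ℕ}, (Fin k → ℕ) → R) : Prop where
  mono : ∀ {H k m}, B H m → k ≤ m → B H k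
  mul : ∀ {H k}, B H (k + 1) → ∀ p, B (S H p) k
  mul_comm : ∀ H p q, S (S H p) q = S (S H q) p
  moment_mul : ∀ {H k}, B H (k + 1) → ∀ (p : ℕ) (a : Fin k → ℕ),
    J (S H p) a = J H (Fin.cons p a : Fin (k + 1) → ℕ) + ∑ i, J H (a + Pi.single i p)

namespace IsMomentSystem

variable {α R : Type*} [AddCommGroup R] {B : α → ℕ → Prop} {S : α → ℕ → α}
  {J : α → ∀ {k : ℕ}, (Fin k → ℕ) → R}

theorem moment_cons (h : IsMomentSystem B S J) {H : α} {k : ℕ} (hH : B H (k + 1)) (p : ℕ)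
    (a : Fin k → ℕ) :
    J H (Fin.cons p a : Fin (k + 1) → ℕ) = J (S H p) a - ∑ i, J H (a + Pi.single i p) :=
  eq_sub_of_add_eq (h.moment_mul hH p a).symm

theorem cons_add_single_zero {k : ℕ} (q p : ℕ) (r : Fin k → ℕ) :
    (Fin.cons q r + Pi.single 0 p : Fin (k + 1) → ℕ) = Fin.cons (q + p) r := by
  ext i
  refine Fin.cases ?_ (fun j => ?_) i <;> simp

theorem cons_add_single_succ {k : ℕ} (q p : ℕ) (r : Fin k → ℕ) (j : Fin k) :
    (Fin.cons q r + Pi.single j.succ p : Fin (k + 1) → ℕ) = Fin.cons q (r + Pi.single j p) := by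
  ext i
  refine Fin.cases ?_ (fun l => ?_) i
  · simp
  · simp [Pi.single_apply]

theorem moment_swap (h : IsMomentSystem B S J) {H : α} {k : ℕ} (hH : B H (k + 2)) (p q : ℕ)
    (r : Fin k → ℕ) :
    J H (Fin.cons p (Fin.cons q r : Fin (k + 1) → ℕ) : Fin (k + 2) → ℕ)
      = J H (Fin.cons q (Fin.cons p r : Fin (k + 1) → ℕ) : Fin (k + 2) → ℕ) := by
  have expand : ∀ p q : ℕ, J H (Fin.cons p (Fin.cons q r : Fin (k + 1) → ℕ) : Fin (k + 2) → ℕ)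
      = J (S (S H p) q) r - ∑ j, J H (Fin.cons p (r + Pi.single j q) : Fin (k + 1) → ℕ)
        - ∑ j, ∑ i, J H (r + Pi.single j q + Pi.single i p)
        - J H (Fin.cons (q + p) r : Fin (k + 1) → ℕ)
        - ∑ j, J H (Fin.cons q (r + Pi.single j p) : Fin (k + 1) → ℕ) := by
    intro p q
    have hS : ∀ j, J (S H p) (r + Pi.single j q)
        = J H (Fin.cons p (r + Pi.single j q) : Fin (k + 1) → ℕ)
          + ∑ i, J H (r + Pi.single j q + Pi.single i p) := fun j =>
      h.moment_mul (h.mono hH (by omega)) _ _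
    rw [h.moment_cons hH, h.moment_cons (h.mul hH p), Fin.sum_univ_succ, cons_add_single_zero]
    simp_rw [cons_add_single_succ, hS, Finset.sum_add_distrib]
    abel
  have hsum : ∑ j, ∑ i, J H (r + Pi.single j q + Pi.single i p)
      = ∑ j, ∑ i, J H (r + Pi.single j p + Pi.single i q) := by
    rw [Finset.sum_comm]
    refine Finset.sum_congr rfl fun i _ => Finset.sum_congr rfl fun j _ => ?_
    rw [add_right_comm]
  rw [expand p q, expand q p, h.mul_comm H p q, add_comm q p, hsum]
  abel

theorem single_comp_perm {k : ℕ} (i : Fin k) (p : ℕ) (σ : Equiv.Perm (Fin k)) :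
    (Pi.single (σ i) p : Fin k → ℕ) ∘ σ = Pi.single i p := by
  ext j
  simp [Pi.single_apply]

theorem moment_comp_perm (h : IsMomentSystem B S J) {H : α} {k : ℕ} (hH : B H k) (a : Fin k → ℕ)
    (σ : Equiv.Perm (Fin k)) : J H (a ∘ σ) = J H a := by
  induction k generalizing H with
  | zero => rw [Subsingleton.elim (a ∘ σ) a]
  | succ k ih =>
    have hσ : σ ∈ Submonoid.closure
        (Set.range fun i : Fin k => Equiv.swap i.castSucc i.succ) := by
      rw [Equiv.Perm.mclosure_swap_castSucc_succ]
      trivial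
    induction hσ using Submonoid.closure_induction generalizing a with
    | one => rfl
    | mul σ τ _ _ hσ hτ =>
      rw [Equiv.Perm.coe_mul, ← Function.comp_assoc, hτ, hσ]
    | mem σ hσ =>
      obtain ⟨i, rfl⟩ := hσ
      cases k with
      | zero => exact i.elim0
      | succ k =>
        refine Fin.cases ?_ (fun j => ?_) i
        · obtain ⟨p, q, r, rfl⟩ : ∃ p q r, a = (Fin.cons p (Fin.cons q r : Fin (k + 1) → ℕ) :
              Fin (k + 2) → ℕ) :=
            ⟨a 0, Fin.tail a 0, Fin.tail (Fin.tail a), by simp⟩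
          rw [h.moment_swap hH p q r]
          congr 1
          ext l
          refine Fin.cases ?_ (fun l => Fin.cases ?_ (fun l => ?_) l) l
          · simp
          · simp
          · have h1 : l.succ.succ ≠ (0 : Fin (k + 1)).castSucc := by simp [Fin.ext_iff]
            have h2 : l.succ.succ ≠ (0 : Fin (k + 1)).succ := by simp [Fin.ext_iff]
            rw [Function.comp_apply, Equiv.swap_apply_of_ne_of_ne h1 h2]
            simp
        · set τ := Equiv.swap j.castSucc j.succ with hτ
          have hcomp : a ∘ Equiv.swap j.succ.castSucc j.succ.succ
              = (Fin.cons (a 0) (Fin.tail a ∘ τ) : Fin (k + 2) → ℕ) := by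
            ext l
            refine Fin.cases ?_ (fun l => ?_) l
            · have h1 : (0 : Fin (k + 2)) ≠ j.succ.castSucc := by simp [Fin.ext_iff]
              have h2 : (0 : Fin (k + 2)) ≠ j.succ.succ := by simp [Fin.ext_iff]
              rw [Function.comp_apply, Equiv.swap_apply_of_ne_of_ne h1 h2, Fin.cons_zero]
            · simp only [Function.comp_apply, Fin.cons_succ, Fin.tail, hτ]
              congr 1
              rw [← Fin.succ_castSucc]
              exact (Fin.succ_injective _).swap_apply _ _ _
          have ha : a = (Fin.cons (a 0) (Fin.tail a) : Fin (k + 2) → ℕ) :=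
            (Fin.cons_self_tail a).symm
          rw [hcomp]
          conv_rhs => rw [ha]
          rw [h.moment_cons hH, h.moment_cons hH, ih (h.mul hH _)]
          congr 1
          refine Eq.trans (Finset.sum_congr rfl fun l _ => ?_)
            (Equiv.sum_comp τ fun i => J H (Fin.tail a + Pi.single i (a 0)))
          conv_rhs => rw [← ih (h.mono hH (by omega)) _ τ, Pi.add_comp, single_comp_perm]

theorem exists_perm_comp_eq {k : ℕ} {β : Type*} {a b : Fin k → β}
    (hab : (univ : Finset (Fin k)).val.map a = (univ : Finset (Fin k)).val.map b) :
    ∃ σ : Equiv.Perm (Fin k), b ∘ σ = a := by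
  classical
  have hcard : ∀ m, Fintype.card {i // a i = m} = Fintype.card {i // b i = m} := by
    intro m
    have := congrArg (Multiset.count m) hab
    simp only [Multiset.count_map] at this
    rw [Fintype.card_subtype, Fintype.card_subtype]
    simpa [Finset.card, eq_comm] using this
  refine ⟨Equiv.ofFiberEquiv fun m => Fintype.equivOfCardEq (hcard m), ?_⟩
  ext i
  exact Equiv.ofFiberEquiv_map _ _

theorem moment_congr (h : IsMomentSystem B S J) {H : α} {k k' : ℕ} (hH : B H k) {a : Fin k → ℕ}
    {b : Fin k' → ℕ} (hab : (univ : Finset (Fin k)).val.map a = (univ : Finset (Fin k')).val.map b) :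
    J H a = J H b := by
  obtain rfl : k = k' := by simpa using congrArg Multiset.card hab
  obtain ⟨σ, rfl⟩ := exists_perm_comp_eq hab
  exact h.moment_comp_perm hH b σ

/-- The moment of `H` with the exponents given by a multiset. -/
noncomputable def blockMoment (J : α → ∀ {k : ℕ}, (Fin k → ℕ) → R) (H : α) (s : Multiset ℕ) : R :=
  J H s.toList.get

theorem map_get_toList (s : Multiset ℕ) :
    (univ : Finset (Fin s.toList.length)).val.map s.toList.get = s := by
  rw [Fin.univ_val_map, List.ofFn_get, Multiset.coe_toList]

theorem moment_eq_blockMoment (h : IsMomentSystem B S J) {H : α} {k : ℕ} (hH : B H k)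
    (a : Fin k → ℕ) : J H a = blockMoment J H ((univ : Finset (Fin k)).val.map a) :=
  h.moment_congr hH (map_get_toList _).symm

theorem map_add_single {k : ℕ} (a : Fin k → ℕ) (i : Fin k) (p : ℕ) :
    (univ : Finset (Fin k)).val.map (a + Pi.single i p)
      = (a i + p) ::ₘ ((univ : Finset (Fin k)).val.map a).erase (a i) := by
  have hi : (univ : Finset (Fin k)).val = i ::ₘ (univ.erase i).val := by
    rw [Finset.erase_val]
    exact (Multiset.cons_erase (mem_univ i)).symm
  rw [hi, Multiset.map_cons, Multiset.map_cons, Multiset.erase_cons_head]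
  congr 1
  · simp
  · refine Multiset.map_congr rfl fun j hj => ?_
    have : j ≠ i := by
      rw [Finset.mem_val, Finset.mem_erase] at hj
      exact hj.1
    simp [this]

theorem blockMoment_mul (h : IsMomentSystem B S J) {H : α} {s : Multiset ℕ}
    (hH : B H (s.card + 1)) (p : ℕ) :
    blockMoment J (S H p) s = blockMoment J H (p ::ₘ s)
      + (s.map fun b => blockMoment J H ((b + p) ::ₘ s.erase b)).sum := by
  have hlen : s.toList.length = s.card := Multiset.length_toList s
  rw [← hlen] at hH
  rw [blockMoment, h.moment_mul hH, h.moment_eq_blockMoment hH]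
  congr 1
  · rw [Fin.univ_val_map, List.ofFn_succ, ← Multiset.cons_coe]
    simp_rw [Fin.cons_zero, Fin.cons_succ]
    rw [← Fin.univ_val_map, map_get_toList]
  · calc ∑ i, J H (s.toList.get + Pi.single i p)
        = ∑ i, blockMoment J H ((s.toList.get i + p) ::ₘ s.erase (s.toList.get i)) := by
          refine Finset.sum_congr rfl fun i _ => ?_
          rw [h.moment_eq_blockMoment (h.mono hH (Nat.le_succ _)), map_add_single, map_get_toList]
      _ = ((univ.val.map s.toList.get).map
            fun b => blockMoment J H ((b + p) ::ₘ s.erase b)).sum := by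
          rw [Multiset.map_map]
          rfl
      _ = _ := by rw [map_get_toList]

theorem sum_finpartition (h : IsMomentSystem B S J) {β : Type*} [DecidableEq β] (s : Finset β)
    {H : α} (hH : B H s.card) :
    ∑ P : Finpartition s, blockMoment J H (P.parts.val.map Finset.card)
      = blockMoment J ((fun H => S H 1)^[s.card] H) 0 := by
  induction s using Finset.induction_on generalizing H with
  | empty =>
    have : Unique (Finpartition (∅ : Finset β)) :=
      inferInstanceAs (Unique (Finpartition (⊥ : Finset β)))
    refine (Fintype.sum_subsingleton _ (Finpartition.empty (Finset β))).trans ?_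
    rfl
  | insert a s ha ih =>
    rw [Finpartition.sum_insert_blockSizes ha, card_insert_of_notMem ha, Function.iterate_succ_apply]
    rw [card_insert_of_notMem ha] at hH
    rw [← ih (h.mul hH 1)]
    refine Finset.sum_congr rfl fun Q _ => ?_
    refine (h.blockMoment_mul (h.mono hH ?_) 1).symm
    simpa using Q.card_parts_le_card

end IsMomentSystem

end Papangelou

namespace Papangelou

open ProbabilityTheory
open scoped ENNReal NNReal

variable {E : Type*} [MeasurableSpace E]

theorem measurable_restrict_measure {K : Set E} (hK : MeasurableSet K) :
    Measurable fun ξ : Measure E => ξ.restrict K := by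
  refine Measure.measurable_of_measurable_coe _ fun s hs => ?_
  simp_rw [Measure.restrict_apply hs]
  exact Measure.measurable_coe (hs.inter hK)

open Classical in
/-- The kernel sending a configuration `ξ` to its restriction to `K` if `ξ K < ∞` and to `0`
otherwise. -/
noncomputable def restrictKernel (K : Set E) (hK : MeasurableSet K) : Kernel (Measure E) E :=
  Kernel.piecewise (s := {ξ | ξ K < ∞}) (measurableSet_lt (Measure.measurable_coe hK)
    measurable_const) ⟨fun ξ => ξ.restrict K, measurable_restrict_measure hK⟩ 0

theorem restrictKernel_of_lt_top {K : Set E} (hK : MeasurableSet K) {ξ : Measure E}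
    (h : ξ K < ∞) : restrictKernel K hK ξ = ξ.restrict K := by
  simp [restrictKernel, Kernel.piecewise_apply, h]

theorem restrictKernel_of_eq_top {K : Set E} (hK : MeasurableSet K) {ξ : Measure E}
    (h : ξ K = ∞) : restrictKernel K hK ξ = 0 := by
  simp [restrictKernel, Kernel.piecewise_apply, h]

theorem restrictKernel_univ_le {K : Set E} (hK : MeasurableSet K) (ξ : Measure E) :
    restrictKernel K hK ξ Set.univ ≤ ξ K := by
  by_cases h : ξ K < ∞
  · simp [restrictKernel_of_lt_top hK h]
  · simp [restrictKernel_of_eq_top hK (not_lt_top_iff.1 h)]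

instance isFiniteMeasure_restrictKernel {K : Set E} (hK : MeasurableSet K) (ξ : Measure E) :
    IsFiniteMeasure (restrictKernel K hK ξ) := by
  by_cases h : ξ K < ∞
  · refine ⟨?_⟩
    simpa [restrictKernel_of_lt_top hK h] using h
  · rw [restrictKernel_of_eq_top hK (not_lt_top_iff.1 h)]
    infer_instance

open Classical in
instance isSFiniteKernel_restrictKernel {K : Set E} (hK : MeasurableSet K) :
    IsSFiniteKernel (restrictKernel K hK) := by
  have hs : ∀ m : ℕ, MeasurableSet {ξ : Measure E | ⌊(ξ K).toReal⌋₊ = m} := fun m =>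
    (Measure.measurable_coe hK).ennreal_toReal.nat_floor (measurableSet_singleton m)
  refine ⟨⟨fun m => Kernel.piecewise (hs m) (restrictKernel K hK) 0, fun m => ?_, ?_⟩⟩
  · refine ⟨⟨m + 1, by simp, fun ξ => ?_⟩⟩
    rw [Kernel.piecewise_apply]
    split_ifs with h
    · by_cases hξ : ξ K < ∞
      · refine (restrictKernel_univ_le hK ξ).trans ?_
        rw [← ENNReal.ofReal_toReal hξ.ne]
        refine (ENNReal.ofReal_le_ofReal (Nat.lt_floor_add_one (ξ K).toReal).le).trans ?_
        rw [show ⌊(ξ K).toReal⌋₊ = m from h]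
        rw [ENNReal.ofReal_add (by positivity) (by positivity)]
        simp
      · simp [restrictKernel_of_eq_top hK (not_lt_top_iff.1 hξ)]
    · simp
  · ext ξ s hsm
    rw [Kernel.sum_apply' _ _ hsm, tsum_eq_single ⌊(ξ K).toReal⌋₊]
    · simp [Kernel.piecewise_apply]
    · intro m hm
      rw [Kernel.piecewise_apply, if_neg (by simpa using hm.symm)]
      simp

theorem measurable_add_sum_dirac {k : ℕ} (s : Finset (Fin k)) :
    Measurable fun p : (Fin k → E) × Measure E => p.2 + ∑ j ∈ s, Measure.dirac (p.1 j) := by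
  refine measurable_snd.add ?_
  exact Finset.measurable_fun_sum _ fun j _ =>
    Measure.measurable_dirac.comp ((measurable_pi_apply j).comp measurable_fst)

theorem measurable_chat {c : E → Measure E → ℝ≥0∞} (hc : Measurable (Function.uncurry c)) (k : ℕ) :
    Measurable fun p : (Fin k → E) × Measure E => chat c p.1 p.2 := by
  refine Finset.measurable_fun_prod _ fun l _ => ?_
  exact hc.comp (((measurable_pi_apply l).comp measurable_fst).prodMk (measurable_add_sum_dirac _))

theorem chat_cons (c : E → Measure E → ℝ≥0∞) {k : ℕ} (y : E) (x : Fin k → E) (ξ : Measure E) :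
    chat c (Fin.cons y x : Fin (k + 1) → E) ξ = c y ξ * chat c x (ξ + Measure.dirac y) := by
  unfold chat
  rw [Fin.prod_univ_succ]
  congr 1
  · simp
  · refine Finset.prod_congr rfl fun l _ => ?_
    rw [Finset.sum_filter, Fin.sum_univ_succ, Finset.sum_filter]
    simp [Fin.succ_lt_succ_iff, add_assoc]

/-- The `k`-th factorial Campbell measure on `K ^ k`, in the form given by the compound Papangelou
intensity. -/
noncomputable def campbell (lam : Measure E) (μ : Measure (Measure E)) (c : E → Measure E → ℝ≥0∞)
    (K : Set E) (k : ℕ) : Measure ((Fin k → E) × Measure E) :=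
  ((((Measure.pi fun _ : Fin k => lam.restrict K).prod μ).withDensity
    fun p => chat c p.1 p.2).map fun p => (p.1, p.2 + ∑ l, Measure.dirac (p.1 l)))

variable {lam : Measure E} [SigmaFinite lam] {μ : Measure (Measure E)} [IsProbabilityMeasure μ]
  {c : E → Measure E → ℝ≥0∞} {K : Set E}

instance sFinite_campbell (k : ℕ) : SFinite (campbell lam μ c K k) := by
  unfold campbell
  infer_instance

theorem measurable_shift (k : ℕ) :
    Measurable fun p : (Fin k → E) × Measure E => (p.1, p.2 + ∑ l, Measure.dirac (p.1 l)) :=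
  measurable_fst.prodMk (measurable_add_sum_dirac _)

theorem lintegral_campbell (hc : Measurable (Function.uncurry c)) {k : ℕ}
    {G : (Fin k → E) × Measure E → ℝ≥0∞} (hG : Measurable G) :
    ∫⁻ p, G p ∂campbell lam μ c K k
      = ∫⁻ ξ, ∫⁻ x, chat c x ξ * G (x, ξ + ∑ l, Measure.dirac (x l))
          ∂(Measure.pi fun _ => lam.restrict K) ∂μ := by
  have hG' := hG.comp (measurable_shift (E := E) k)
  rw [campbell, lintegral_map hG (measurable_shift k)]
  change ∫⁻ p, (G ∘ fun p : (Fin k → E) × Measure E =>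
    (p.1, p.2 + ∑ l, Measure.dirac (p.1 l))) p ∂_ = _
  rw [lintegral_withDensity_eq_lintegral_mul _ (measurable_chat hc k) hG',
    lintegral_prod_symm' _ ((measurable_chat hc k).mul hG')]
  rfl

theorem lintegral_pi_succ {k : ℕ} {ν : Measure E} [SigmaFinite ν] {f : (Fin (k + 1) → E) → ℝ≥0∞}
    (hf : Measurable f) :
    ∫⁻ x, f x ∂(Measure.pi fun _ => ν)
      = ∫⁻ y, ∫⁻ x, f (Fin.cons y x) ∂(Measure.pi fun _ => ν) ∂ν := by
  have h := (measurePreserving_piFinSuccAbove (fun _ : Fin (k + 1) => ν) 0).symm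
  rw [← h.lintegral_comp hf]
  refine (lintegral_prod (μ := ν) (ν := Measure.pi fun _ : Fin k => ν)
    (f ∘ (MeasurableEquiv.piFinSuccAbove (fun _ => E) 0).symm)
    (hf.comp h.measurable).aemeasurable).trans ?_
  refine lintegral_congr fun y => lintegral_congr fun x => ?_
  rw [← Fin.insertNth_zero']
  rfl

theorem measurable_cons (k : ℕ) :
    Measurable fun p : E × (Fin k → E) => (Fin.cons p.1 p.2 : Fin (k + 1) → E) := by
  refine measurable_pi_lambda _ fun i => ?_
  refine Fin.cases ?_ (fun j => ?_) i
  · simpa using measurable_fst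
  · exact (measurable_pi_apply j).comp measurable_snd

theorem ae_mem_of_pi_restrict (hK : MeasurableSet K) (k : ℕ) :
    ∀ᵐ x ∂(Measure.pi fun _ : Fin k => lam.restrict K), ∀ l, x l ∈ K := by
  rw [ae_all_iff]
  intro l
  exact (Measure.quasiMeasurePreserving_eval (μ := fun _ : Fin k => lam.restrict K) l).ae
    (ae_restrict_mem hK)

theorem restrictKernel_add_sum_dirac (hK : MeasurableSet K) {k : ℕ} {x : Fin k → E}
    (hx : ∀ l, x l ∈ K) {ξ : Measure E} (hξ : ξ K < ∞) :
    restrictKernel K hK (ξ + ∑ l, Measure.dirac (x l))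
      = ξ.restrict K + ∑ l, Measure.dirac (x l) := by
  have h2 : ∀ l, (Measure.dirac (x l)).restrict K = Measure.dirac (x l) := fun l => by
    classical
    rw [restrict_dirac' hK, if_pos (hx l)]
  have h3 : (∑ l, Measure.dirac (x l)).restrict K = ∑ l, Measure.dirac (x l) := by
    rw [← Measure.restrictₗ_apply, map_sum]
    simp [h2]
  rw [restrictKernel_of_lt_top, Measure.restrict_add, h3]
  rw [Measure.add_apply, ENNReal.add_lt_top]
  refine ⟨hξ, ?_⟩
  rw [Measure.finsetSum_apply]
  exact ENNReal.sum_lt_top.2 fun l _ => measure_lt_top _ _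

/-- The GNZ identity. -/
def IsPapangelou (lam : Measure E) (μ : Measure (Measure E)) (c : E → Measure E → ℝ≥0∞) : Prop :=
  ∀ w : E → Measure E → ℝ≥0∞, Measurable (Function.uncurry w) →
    ∫⁻ ξ, (∫⁻ x, w x ξ ∂ξ) ∂μ = ∫⁻ ξ, ∫⁻ x, w x (ξ + Measure.dirac x) * c x ξ ∂lam ∂μ

/-- Removing the first point of the factorial Campbell measure by the GNZ identity. -/
theorem lintegral_campbell_succ (hc : Measurable (Function.uncurry c))
    (hGNZ : IsPapangelou lam μ c) (hK : MeasurableSet K) (hfin : ∀ᵐ ξ ∂μ, ξ K < ∞) {k : ℕ}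
    {G : (Fin (k + 1) → E) × Measure E → ℝ≥0∞} (hG : Measurable G) :
    ∫⁻ p, G p ∂campbell lam μ c K (k + 1)
        + ∑ l, ∫⁻ p, G (Fin.cons (p.1 l) p.1, p.2) ∂campbell lam μ c K k
      = ∫⁻ p, ∫⁻ y, G (Fin.cons y p.1, p.2) ∂restrictKernel K hK p.2 ∂campbell lam μ c K k := by
  have hGcons : Measurable fun q : ((Fin k → E) × Measure E) × E =>
      G (Fin.cons q.2 q.1.1, q.1.2) :=
    hG.comp (((measurable_cons k).comp
      (measurable_snd.prodMk (measurable_fst.comp measurable_fst))).prodMk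
      (measurable_snd.comp measurable_fst))
  have hGy : ∀ x ξ, Measurable fun y => G (Fin.cons y x, ξ) := fun x ξ =>
    hGcons.comp (measurable_const (a := (x, ξ)).prodMk measurable_id)
  have hint : Measurable fun q : ((Fin k → E) × Measure E) × E =>
      chat c q.1.1 q.1.2 * G (Fin.cons q.2 q.1.1, q.1.2 + ∑ l, Measure.dirac (q.1.1 l)) :=
    ((measurable_chat hc k).comp measurable_fst).mul
      (hGcons.comp (((measurable_shift k).comp measurable_fst).prodMk measurable_snd))
  have hdup : ∀ l, Measurable fun p : (Fin k → E) × Measure E =>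
      G (Fin.cons (p.1 l) p.1, p.2) := fun l =>
    hGcons.comp (measurable_id.prodMk ((measurable_pi_apply l).comp measurable_fst))
  have hdup' : ∀ l, Measurable fun p : (Fin k → E) × Measure E =>
      chat c p.1 p.2 * G (Fin.cons (p.1 l) p.1, p.2 + ∑ l, Measure.dirac (p.1 l)) := fun l =>
    (measurable_chat hc k).mul ((hdup l).comp (measurable_shift k))
  set g : E → Measure E → ℝ≥0∞ := fun y ξ => ∫⁻ x, chat c x ξ *
    G (Fin.cons y x, ξ + ∑ l, Measure.dirac (x l)) ∂(Measure.pi fun _ => lam.restrict K) with hg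
  have hgm : Measurable (Function.uncurry g) :=
    Measurable.lintegral_prod_right' (ν := Measure.pi fun _ : Fin k => lam.restrict K)
      (f := fun q : (E × Measure E) × (Fin k → E) => chat c q.2 q.1.2 *
        G (Fin.cons q.1.1 q.2, q.1.2 + ∑ l, Measure.dirac (q.2 l)))
      (hint.comp ((measurable_snd.prodMk (measurable_snd.comp measurable_fst)).prodMk
        (measurable_fst.comp measurable_fst)))
  have hwm : Measurable (Function.uncurry fun y ξ => K.indicator (fun y => g y ξ) y) := by
    have : (Function.uncurry fun y ξ => K.indicator (fun y => g y ξ) y)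
        = (Prod.fst ⁻¹' K).indicator (Function.uncurry g) := by
      ext ⟨y, ξ⟩
      rfl
    rw [this]
    exact hgm.indicator (measurable_fst hK)
  have hfirst : ∫⁻ p, G p ∂campbell lam μ c K (k + 1)
      = ∫⁻ ξ, ∫⁻ x, chat c x ξ * ∫⁻ y in K, G (Fin.cons y x, ξ + ∑ l, Measure.dirac (x l)) ∂ξ
          ∂(Measure.pi fun _ => lam.restrict K) ∂μ := by
    rw [lintegral_campbell hc hG]
    calc _ = ∫⁻ ξ, ∫⁻ y, K.indicator (fun z => g z (ξ + Measure.dirac y)) y * c y ξ ∂lam ∂μ := by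
          refine lintegral_congr fun ξ => ?_
          have hfull : Measurable fun x : Fin (k + 1) → E =>
              chat c x ξ * G (x, ξ + ∑ l, Measure.dirac (x l)) :=
            ((measurable_chat hc _).mul (hG.comp (measurable_shift _))).comp
              (measurable_id.prodMk measurable_const)
          rw [lintegral_pi_succ hfull, ← lintegral_indicator hK]
          refine lintegral_congr fun y => ?_
          by_cases hy : y ∈ K
          · simp only [Set.indicator_of_mem hy, hg]
            rw [mul_comm, ← lintegral_const_mul]
            · refine lintegral_congr fun x => ?_
              rw [chat_cons, Fin.sum_univ_succ, mul_assoc]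
              simp [add_assoc]
            · exact hint.comp ((measurable_id.prodMk measurable_const).prodMk measurable_const)
          · simp [hy]
      _ = ∫⁻ ξ, ∫⁻ y, K.indicator (fun z => g z ξ) y ∂ξ ∂μ := (hGNZ _ hwm).symm
      _ = _ := by
          refine lintegral_congr_ae ?_
          filter_upwards [hfin] with ξ hξ
          have : IsFiniteMeasure (ξ.restrict K) := ⟨by simpa using hξ⟩
          rw [lintegral_indicator hK]
          simp only [hg]
          rw [lintegral_lintegral_swap]
          · refine lintegral_congr fun x => ?_
            rw [lintegral_const_mul]
            exact hGy _ _
          · exact (hint.comp ((measurable_snd.prodMk measurable_const).prodMk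
              measurable_fst)).aemeasurable
  have hker : Measurable fun p : (Fin k → E) × Measure E =>
      ∫⁻ y, G (Fin.cons y p.1, p.2) ∂restrictKernel K hK p.2 :=
    Measurable.lintegral_kernel_prod_right'
      (κ := (restrictKernel K hK).comap (Prod.snd : (Fin k → E) × Measure E → _) measurable_snd)
      hGcons
  rw [lintegral_campbell hc hker, hfirst]
  simp_rw [fun l => lintegral_campbell (lam := lam) (μ := μ) (K := K) hc (hdup l)]
  rw [← lintegral_finsetSum, ← lintegral_add_right]
  · refine lintegral_congr_ae ?_
    filter_upwards [hfin] with ξ hξ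
    rw [← lintegral_finsetSum, ← lintegral_add_right]
    · refine lintegral_congr_ae ?_
      filter_upwards [ae_mem_of_pi_restrict hK k] with x hx
      rw [restrictKernel_add_sum_dirac hK hx hξ, lintegral_add_measure,
        lintegral_finsetSum_measure, mul_add, Finset.mul_sum]
      congr 1
      refine Finset.sum_congr rfl fun l _ => ?_
      rw [lintegral_dirac']
      exact hGy _ _
    · exact Finset.measurable_fun_sum _ fun l _ =>
        (hdup' l).comp (measurable_id.prodMk measurable_const)
    · exact fun l _ => (hdup' l).comp (measurable_id.prodMk measurable_const)
  · exact Finset.measurable_fun_sum _ fun l _ =>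
      Measurable.lintegral_prod_left' (hdup' l)
  · exact fun l _ => Measurable.lintegral_prod_left' (hdup' l)

theorem measurable_consMap (k : ℕ) : Measurable fun q : ((Fin k → E) × Measure E) × E =>
    ((Fin.cons q.2 q.1.1 : Fin (k + 1) → E), q.1.2) :=
  ((measurable_cons k).comp (measurable_snd.prodMk (measurable_fst.comp measurable_fst))).prodMk
    (measurable_snd.comp measurable_fst)

theorem measurable_dupMap {k : ℕ} (l : Fin k) : Measurable fun p : (Fin k → E) × Measure E =>
    ((Fin.cons (p.1 l) p.1 : Fin (k + 1) → E), p.2) := by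
  have h : Measurable fun p : (Fin k → E) × Measure E => (p, p.1 l) :=
    measurable_id.prodMk ((measurable_pi_apply l).comp measurable_fst)
  exact (measurable_consMap k).comp h

theorem campbell_succ (hc : Measurable (Function.uncurry c)) (hGNZ : IsPapangelou lam μ c)
    (hK : MeasurableSet K) (hfin : ∀ᵐ ξ ∂μ, ξ K < ∞) (k : ℕ) :
    campbell lam μ c K (k + 1)
        + ∑ l, (campbell lam μ c K k).map (fun p => (Fin.cons (p.1 l) p.1, p.2))
      = (campbell lam μ c K k ⊗ₘ (restrictKernel K hK).comap Prod.snd measurable_snd).map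
          (fun q => (Fin.cons q.2 q.1.1, q.1.2)) := by
  refine Measure.ext_of_lintegral _ fun G hG => ?_
  have hG' : Measurable fun q : ((Fin k → E) × Measure E) × E =>
      G (Fin.cons q.2 q.1.1, q.1.2) := hG.comp (measurable_consMap k)
  rw [lintegral_add_measure, lintegral_finsetSum_measure, lintegral_map hG (measurable_consMap k),
    Measure.lintegral_compProd hG']
  simp_rw [fun l => lintegral_map (μ := campbell lam μ c K k) hG (measurable_dupMap l)]
  exact lintegral_campbell_succ hc hGNZ hK hfin hG

theorem lintegral_campbell_zero (hc : Measurable (Function.uncurry c))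
    {h : Measure E → ℝ≥0∞} (hh : Measurable h) :
    ∫⁻ p, h p.2 ∂campbell lam μ c K 0 = ∫⁻ ξ, h ξ ∂μ := by
  have hh' : Measurable fun p : (Fin 0 → E) × Measure E => h p.2 := hh.comp measurable_snd
  rw [lintegral_campbell hc hh']
  simp [chat]

theorem lintegral_campbell_le (hc : Measurable (Function.uncurry c))
    (hGNZ : IsPapangelou lam μ c) (hK : MeasurableSet K) (hfin : ∀ᵐ ξ ∂μ, ξ K < ∞) (k : ℕ)
    {h : Measure E → ℝ≥0∞} (hh : Measurable h) :
    ∫⁻ p, h p.2 ∂campbell lam μ c K k ≤ ∫⁻ ξ, h ξ * (ξ K) ^ k ∂μ := by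
  induction k generalizing h with
  | zero => simp [lintegral_campbell_zero hc hh]
  | succ k ih =>
    calc ∫⁻ p, h p.2 ∂campbell lam μ c K (k + 1)
        ≤ ∫⁻ p, ∫⁻ _, h p.2 ∂restrictKernel K hK p.2 ∂campbell lam μ c K k := by
          have hh' : Measurable fun p : (Fin (k + 1) → E) × Measure E => h p.2 :=
            hh.comp measurable_snd
          rw [← lintegral_campbell_succ hc hGNZ hK hfin hh']
          exact le_self_add
      _ ≤ ∫⁻ p, h p.2 * p.2 K ∂campbell lam μ c K k := by
          refine lintegral_mono fun p => ?_
          rw [lintegral_const]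
          exact mul_le_mul' le_rfl (restrictKernel_univ_le hK _)
      _ ≤ ∫⁻ ξ, h ξ * ξ K * (ξ K) ^ k ∂μ :=
          ih (h := fun ξ => h ξ * ξ K) (hh.mul (Measure.measurable_coe hK))
      _ = ∫⁻ ξ, h ξ * (ξ K) ^ (k + 1) ∂μ := by simp_rw [pow_succ', mul_assoc]

/-- `H` is integrable against the `k`-th power of the number of particles in `K`. -/
def MomentBound (μ : Measure (Measure E)) (K : Set E) (H : Measure E → ℝ) (k : ℕ) : Prop :=
  Measurable H ∧ ∫⁻ ξ, ‖H ξ‖ₑ * (1 + ξ K) ^ k ∂μ < ∞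

theorem MomentBound.mono {μ : Measure (Measure E)} {H : Measure E → ℝ} {k m : ℕ}
    (h : MomentBound μ K H m) (hkm : k ≤ m) :
    MomentBound μ K H k := by
  refine ⟨h.1, lt_of_le_of_lt (lintegral_mono fun ξ => ?_) h.2⟩
  dsimp only
  gcongr
  exact le_self_add

/-- The integral over `K` of the `p`-th power of the process `u`. -/
noncomputable def powerIntegral (hK : MeasurableSet K) (u : E → Measure E → ℝ) (p : ℕ)
    (ξ : Measure E) : ℝ :=
  ∫ y, u y ξ ^ p ∂restrictKernel K hK ξ

/-- The integral of `H` and powers of the process `u` against the factorial Campbell measure. -/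
noncomputable def campbellMoment (lam : Measure E) (μ : Measure (Measure E))
    (c : E → Measure E → ℝ≥0∞) (K : Set E) (u : E → Measure E → ℝ) (H : Measure E → ℝ)
    {k : ℕ} (a : Fin k → ℕ) : ℝ :=
  ∫ p, (∏ l, u (p.1 l) p.2 ^ a l) * H p.2 ∂campbell lam μ c K k

variable {u : E → Measure E → ℝ} {D : ℝ}

theorem measurable_powerIntegral (hK : MeasurableSet K) (hu : Measurable (Function.uncurry u))
    (p : ℕ) : Measurable (powerIntegral hK u p) :=
  (StronglyMeasurable.integral_kernel_prod_right' (κ := restrictKernel K hK)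
    (f := fun q : Measure E × E => u q.2 q.1 ^ p)
    ((hu.comp measurable_swap).pow_const p).stronglyMeasurable).measurable

theorem enorm_powerIntegral_le (hK : MeasurableSet K) (hD : ∀ x ξ, |u x ξ| ≤ D) (p : ℕ)
    (ξ : Measure E) : ‖powerIntegral hK u p ξ‖ₑ ≤ ENNReal.ofReal (D ^ p) * ξ K := by
  refine (enorm_integral_le_lintegral_enorm _).trans ?_
  calc ∫⁻ y, ‖u y ξ ^ p‖ₑ ∂restrictKernel K hK ξ
      ≤ ∫⁻ _, ENNReal.ofReal (D ^ p) ∂restrictKernel K hK ξ := by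
        refine lintegral_mono fun y => ?_
        rw [Real.enorm_eq_ofReal_abs, abs_pow]
        exact ENNReal.ofReal_le_ofReal (pow_le_pow_left₀ (abs_nonneg _) (hD _ _) _)
    _ ≤ _ := by
        rw [lintegral_const]
        exact mul_le_mul' le_rfl (restrictKernel_univ_le hK _)

theorem MomentBound.mul_powerIntegral {μ : Measure (Measure E)} (hK : MeasurableSet K)
    (hu : Measurable (Function.uncurry u)) (hD : ∀ x ξ, |u x ξ| ≤ D) {H : Measure E → ℝ} {k : ℕ}
    (h : MomentBound μ K H (k + 1)) (p : ℕ) :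
    MomentBound μ K (fun ξ => H ξ * powerIntegral hK u p ξ) k := by
  refine ⟨h.1.mul (measurable_powerIntegral hK hu p), ?_⟩
  calc ∫⁻ ξ, ‖H ξ * powerIntegral hK u p ξ‖ₑ * (1 + ξ K) ^ k ∂μ
      ≤ ∫⁻ ξ, ENNReal.ofReal (D ^ p) * (‖H ξ‖ₑ * (1 + ξ K) ^ (k + 1)) ∂μ := by
        refine lintegral_mono fun ξ => ?_
        dsimp only
        rw [enorm_mul]
        calc ‖H ξ‖ₑ * ‖powerIntegral hK u p ξ‖ₑ * (1 + ξ K) ^ k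
            ≤ ‖H ξ‖ₑ * (ENNReal.ofReal (D ^ p) * (1 + ξ K)) * (1 + ξ K) ^ k := by
              gcongr
              refine (enorm_powerIntegral_le hK hD p ξ).trans ?_
              gcongr
              exact le_add_self
          _ = _ := by ring
    _ = ENNReal.ofReal (D ^ p) * ∫⁻ ξ, ‖H ξ‖ₑ * (1 + ξ K) ^ (k + 1) ∂μ :=
        lintegral_const_mul' _ _ ENNReal.ofReal_ne_top
    _ < ∞ := ENNReal.mul_lt_top ENNReal.ofReal_lt_top h.2

theorem measurable_prod_pow (hu : Measurable (Function.uncurry u)) {k : ℕ} (a : Fin k → ℕ) :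
    Measurable fun p : (Fin k → E) × Measure E => ∏ l, u (p.1 l) p.2 ^ a l :=
  Finset.measurable_fun_prod _ fun l _ => by
    have h : Measurable fun p : (Fin k → E) × Measure E => (p.1 l, p.2) :=
      ((measurable_pi_apply l).comp measurable_fst).prodMk measurable_snd
    exact (hu.comp h).pow_const (a l)

theorem measurable_momentIntegrand (hu : Measurable (Function.uncurry u)) {H : Measure E → ℝ}
    (hH : Measurable H) {k : ℕ} (a : Fin k → ℕ) :
    Measurable fun p : (Fin k → E) × Measure E => (∏ l, u (p.1 l) p.2 ^ a l) * H p.2 :=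
  (measurable_prod_pow hu a).mul (hH.comp measurable_snd)

theorem MomentBound.integrable (hc : Measurable (Function.uncurry c))
    (hGNZ : IsPapangelou lam μ c) (hK : MeasurableSet K) (hfin : ∀ᵐ ξ ∂μ, ξ K < ∞)
    (hu : Measurable (Function.uncurry u)) (hD : ∀ x ξ, |u x ξ| ≤ D)
    {H : Measure E → ℝ} {k : ℕ} (h : MomentBound μ K H k) (a : Fin k → ℕ) :
    Integrable (fun p : (Fin k → E) × Measure E => (∏ l, u (p.1 l) p.2 ^ a l) * H p.2)
      (campbell lam μ c K k) := by
  have hint : Integrable (fun p : (Fin k → E) × Measure E => H p.2) (campbell lam μ c K k) := by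
    refine ⟨(h.1.comp measurable_snd).aestronglyMeasurable, lt_of_le_of_lt ?_ h.2⟩
    refine (lintegral_campbell_le hc hGNZ hK hfin k h.1.enorm).trans (lintegral_mono fun ξ => ?_)
    dsimp only
    gcongr
    exact le_add_self
  refine hint.bdd_mul (c := ∏ l, D ^ a l) (measurable_prod_pow hu a).aestronglyMeasurable
    (.of_forall fun p => ?_)
  rw [Real.norm_eq_abs, Finset.abs_prod]
  refine Finset.prod_le_prod (fun _ _ => abs_nonneg _) fun l _ => ?_
  rw [abs_pow]
  exact pow_le_pow_left₀ (abs_nonneg _) (hD _ _) _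

theorem campbellMoment_mul_powerIntegral (hc : Measurable (Function.uncurry c))
    (hGNZ : IsPapangelou lam μ c) (hK : MeasurableSet K) (hfin : ∀ᵐ ξ ∂μ, ξ K < ∞)
    (hu : Measurable (Function.uncurry u)) (hD : ∀ x ξ, |u x ξ| ≤ D)
    {H : Measure E → ℝ} {k : ℕ} (h : MomentBound μ K H (k + 1)) (p : ℕ) (a : Fin k → ℕ) :
    campbellMoment lam μ c K u (fun ξ => H ξ * powerIntegral hK u p ξ) a
      = campbellMoment lam μ c K u H (Fin.cons p a : Fin (k + 1) → ℕ)
        + ∑ i, campbellMoment lam μ c K u H (a + Pi.single i p) := by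
  set g : (Fin (k + 1) → E) × Measure E → ℝ := fun q =>
    (∏ l, u (q.1 l) q.2 ^ (Fin.cons p a : Fin (k + 1) → ℕ) l) * H q.2 with hg
  have hgm : Measurable g := measurable_momentIntegrand hu h.1 _
  have hgdup : ∀ (l : Fin k) (q : (Fin k → E) × Measure E), g (Fin.cons (q.1 l) q.1, q.2)
      = (∏ j, u (q.1 j) q.2 ^ (a + Pi.single l p : Fin k → ℕ) j) * H q.2 := by
    intro l q
    simp only [hg, Fin.prod_univ_succ, Fin.cons_zero, Fin.cons_succ, Pi.add_apply, pow_add,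
      Finset.prod_mul_distrib]
    congr 1
    rw [mul_comm]
    congr 1
    rw [Finset.prod_eq_single l (fun b _ hb => by simp [hb]) (by simp)]
    simp
  have hgcons : ∀ q : ((Fin k → E) × Measure E) × E, g (Fin.cons q.2 q.1.1, q.1.2)
      = (∏ j, u (q.1.1 j) q.1.2 ^ a j) * H q.1.2 * u q.2 q.1.2 ^ p := by
    intro q
    simp only [hg, Fin.prod_univ_succ, Fin.cons_zero, Fin.cons_succ]
    ring
  have hi1 : Integrable g (campbell lam μ c K (k + 1)) := h.integrable hc hGNZ hK hfin hu hD _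
  have hi2 : ∀ l, Integrable g
      ((campbell lam μ c K k).map (fun q => (Fin.cons (q.1 l) q.1, q.2))) := by
    intro l
    rw [integrable_map_measure hgm.aestronglyMeasurable (measurable_dupMap l).aemeasurable]
    exact ((h.mono k.le_succ).integrable hc hGNZ hK hfin hu hD _).congr
      (.of_forall fun q => (hgdup l q).symm)
  have hi3 : Integrable g (∑ l, (campbell lam μ c K k).map
      (fun q => (Fin.cons (q.1 l) q.1, q.2))) :=
    integrable_finsetSum_measure.2 fun l _ => hi2 l
  have hi4 := hi1.add_measure hi3
  have key := integral_add_measure hi1 hi3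
  rw [campbell_succ hc hGNZ hK hfin] at hi4 key
  have hi5 : Integrable (fun q : ((Fin k → E) × Measure E) × E => g (Fin.cons q.2 q.1.1, q.1.2))
      (campbell lam μ c K k ⊗ₘ (restrictKernel K hK).comap Prod.snd measurable_snd) :=
    (integrable_map_measure hgm.aestronglyMeasurable (measurable_consMap k).aemeasurable).1 hi4
  rw [integral_finsetSum_measure fun l _ => hi2 l,
    integral_map (measurable_consMap k).aemeasurable hgm.aestronglyMeasurable,
    Measure.integral_compProd hi5] at key
  have hdup : ∀ l, ∫ q, g q ∂(campbell lam μ c K k).map (fun q => (Fin.cons (q.1 l) q.1, q.2))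
      = campbellMoment lam μ c K u H (a + Pi.single l p) := fun l => by
    rw [integral_map (measurable_dupMap l).aemeasurable hgm.aestronglyMeasurable]
    exact integral_congr_ae (.of_forall (hgdup l))
  rw [Finset.sum_congr rfl fun l _ => hdup l] at key
  refine Eq.trans ?_ key
  refine integral_congr_ae (.of_forall fun q => ?_)
  have hq : ∫ y, g (Fin.cons y q.1, q.2) ∂restrictKernel K hK q.2
      = (∏ j, u (q.1 j) q.2 ^ a j) * H q.2 * powerIntegral hK u p q.2 := by
    rw [powerIntegral, ← integral_const_mul]
    exact integral_congr_ae (.of_forall fun y => hgcons (q, y))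
  simp only [Kernel.comap_apply, hq, mul_assoc]

end Papangelou

namespace Papangelou

open ProbabilityTheory
open scoped ENNReal NNReal

variable {E : Type*} [MeasurableSpace E] {lam : Measure E} [SigmaFinite lam]
  {μ : Measure (Measure E)} [IsProbabilityMeasure μ] {c : E → Measure E → ℝ≥0∞} {K : Set E}
  {u : E → Measure E → ℝ} {D : ℝ}

theorem MomentBound.mul_powerIntegral_pow {μ : Measure (Measure E)} (hK : MeasurableSet K)
    (hu : Measurable (Function.uncurry u)) (hD : ∀ x ξ, |u x ξ| ≤ D) {H : Measure E → ℝ} {k m : ℕ}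
    (h : MomentBound μ K H (k + m)) :
    MomentBound μ K (fun ξ => H ξ * powerIntegral hK u 1 ξ ^ m) k := by
  induction m generalizing k with
  | zero => simpa using h
  | succ m ih =>
    have := (ih (k := k + 1) (by rwa [add_right_comm])).mul_powerIntegral hK hu hD 1
    simpa only [mul_assoc, ← pow_succ] using this

theorem MomentBound.integrable_zero {μ : Measure (Measure E)} {H : Measure E → ℝ}
    (h : MomentBound μ K H 0) :
    Integrable H μ :=
  ⟨h.1.aestronglyMeasurable, by simpa [HasFiniteIntegral] using h.2⟩

/-- The integral of the process `u` against the Papangelou intensity. -/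
noncomputable def compensator (lam : Measure E) (c : E → Measure E → ℝ≥0∞)
    (u : E → Measure E → ℝ) (ξ : Measure E) : ℝ :=
  ∫ z, u z ξ * (c z ξ).toReal ∂lam

theorem measurable_compensator (hc : Measurable (Function.uncurry c))
    (hu : Measurable (Function.uncurry u)) : Measurable (compensator lam c u) :=
  (StronglyMeasurable.integral_prod_right' (ν := lam)
    (f := fun q : Measure E × E => u q.2 q.1 * (c q.2 q.1).toReal)
    ((hu.comp measurable_swap).mul
      (hc.comp measurable_swap).ennreal_toReal).stronglyMeasurable).measurable

theorem enorm_compensator_le {lam : Measure E} (hK : MeasurableSet K) (hD : ∀ x ξ, |u x ξ| ≤ D)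
    (husupp : ∀ x ξ, x ∉ K → u x ξ = 0) (ξ : Measure E) :
    ‖compensator lam c u ξ‖ₑ ≤ ENNReal.ofReal D * ∫⁻ z in K, c z ξ ∂lam := by
  refine (enorm_integral_le_lintegral_enorm _).trans ?_
  rw [← lintegral_const_mul' _ _ ENNReal.ofReal_ne_top, ← lintegral_indicator hK]
  refine lintegral_mono fun z => ?_
  by_cases hz : z ∈ K
  · rw [Set.indicator_of_mem hz, enorm_mul, Real.enorm_eq_ofReal_abs,
      Real.enorm_of_nonneg ENNReal.toReal_nonneg]
    exact mul_le_mul' (ENNReal.ofReal_le_ofReal (hD _ _)) ENNReal.ofReal_toReal_le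
  · simp [hz, husupp z ξ hz]

theorem pow_mul_pow_le_add_pow {R : Type*} [CommSemiring R] [LinearOrder R] [IsOrderedRing R]
    [CanonicallyOrderedAdd R] (a b : R) {i n : ℕ} (hi : i ≤ n) :
    a ^ i * b ^ (n - i) ≤ a ^ n + b ^ n := by
  calc a ^ i * b ^ (n - i) ≤ max a b ^ i * max a b ^ (n - i) :=
        mul_le_mul' (pow_le_pow_left' (le_max_left _ _) _) (pow_le_pow_left' (le_max_right _ _) _)
    _ = max a b ^ n := by rw [← pow_add, Nat.add_sub_cancel' hi]
    _ ≤ a ^ n + b ^ n := by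
      rcases le_total a b with h | h
      · rw [max_eq_right h]
        exact le_add_self
      · rw [max_eq_left h]
        exact le_self_add

theorem momentBound_mul_compensator_pow (hc : Measurable (Function.uncurry c))
    (hK : MeasurableSet K) (hu : Measurable (Function.uncurry u)) (hD : ∀ x ξ, |u x ξ| ≤ D)
    (husupp : ∀ x ξ, x ∉ K → u x ξ = 0) {n i : ℕ} (hi : i ≤ n)
    (hmom : ∫⁻ ξ, (ξ K) ^ n ∂μ < ∞) (hmomc : ∫⁻ ξ, (∫⁻ z in K, c z ξ ∂lam) ^ n ∂μ < ∞)
    {F : Measure E → ℝ} (hF : Measurable F) {CF : ℝ} (hFbd : ∀ ξ, |F ξ| ≤ CF) :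
    MomentBound μ K (fun ξ => F ξ * compensator lam c u ξ ^ i) (n - i) := by
  refine ⟨hF.mul ((measurable_compensator hc hu).pow_const i), ?_⟩
  have hmeas : Measurable fun ξ => ∫⁻ z in K, c z ξ ∂lam :=
    Measurable.lintegral_prod_right' (ν := lam.restrict K)
      (f := fun q : Measure E × E => c q.2 q.1) (hc.comp measurable_swap)
  calc ∫⁻ ξ, ‖F ξ * compensator lam c u ξ ^ i‖ₑ * (1 + ξ K) ^ (n - i) ∂μ
      ≤ ∫⁻ ξ, (ENNReal.ofReal CF * ENNReal.ofReal D ^ i)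
          * ((∫⁻ z in K, c z ξ ∂lam) ^ n + 2 ^ n * (1 + (ξ K) ^ n)) ∂μ := by
        refine lintegral_mono fun ξ => ?_
        dsimp only
        rw [enorm_mul, enorm_pow]
        calc ‖F ξ‖ₑ * ‖compensator lam c u ξ‖ₑ ^ i * (1 + ξ K) ^ (n - i)
            ≤ ENNReal.ofReal CF * (ENNReal.ofReal D * ∫⁻ z in K, c z ξ ∂lam) ^ i
                * (1 + ξ K) ^ (n - i) := by
              refine mul_le_mul' (mul_le_mul' ?_ (pow_le_pow_left' ?_ _)) le_rfl
              · rw [Real.enorm_eq_ofReal_abs]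
                exact ENNReal.ofReal_le_ofReal (hFbd ξ)
              · exact enorm_compensator_le hK hD husupp ξ
          _ = (ENNReal.ofReal CF * ENNReal.ofReal D ^ i)
                * ((∫⁻ z in K, c z ξ ∂lam) ^ i * (1 + ξ K) ^ (n - i)) := by ring
          _ ≤ _ := by
              refine mul_le_mul' le_rfl ((pow_mul_pow_le_add_pow _ _ hi).trans ?_)
              refine add_le_add le_rfl ?_
              rcases le_total (ξ K) 1 with h | h
              · calc (1 + ξ K) ^ n ≤ (1 + 1) ^ n := pow_le_pow_left' (add_le_add le_rfl h) n
                  _ ≤ _ := by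
                    rw [one_add_one_eq_two]
                    exact le_mul_of_one_le_right' le_self_add
              · calc (1 + ξ K) ^ n ≤ (2 * ξ K) ^ n := by
                      rw [two_mul]
                      exact pow_le_pow_left' (add_le_add h le_rfl) n
                  _ ≤ _ := by
                    rw [mul_pow]
                    exact mul_le_mul' le_rfl le_add_self
    _ = (ENNReal.ofReal CF * ENNReal.ofReal D ^ i)
          * (∫⁻ ξ, (∫⁻ z in K, c z ξ ∂lam) ^ n ∂μ + 2 ^ n * (1 + ∫⁻ ξ, (ξ K) ^ n ∂μ)) := by
        rw [lintegral_const_mul' _ _ (ENNReal.mul_ne_top ENNReal.ofReal_ne_top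
            (ENNReal.pow_ne_top ENNReal.ofReal_ne_top)), lintegral_add_left (hmeas.pow_const n),
          lintegral_const_mul' _ _ (ENNReal.pow_ne_top ENNReal.ofNat_ne_top),
          lintegral_add_left measurable_const]
        simp
    _ < ∞ := by finiteness

theorem isMomentSystem_campbellMoment (hc : Measurable (Function.uncurry c))
    (hGNZ : IsPapangelou lam μ c) (hK : MeasurableSet K) (hfin : ∀ᵐ ξ ∂μ, ξ K < ∞)
    (hu : Measurable (Function.uncurry u)) (hD : ∀ x ξ, |u x ξ| ≤ D) :
    IsMomentSystem (MomentBound μ K) (fun H p ξ => H ξ * powerIntegral hK u p ξ)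
      (campbellMoment lam μ c K u) where
  mono := MomentBound.mono
  mul h p := h.mul_powerIntegral hK hu hD p
  mul_comm H p q := by
    ext ξ
    exact mul_right_comm _ _ _
  moment_mul h p a := campbellMoment_mul_powerIntegral hc hGNZ hK hfin hu hD h p a

theorem campbellMoment_zero (hc : Measurable (Function.uncurry c)) {H : Measure E → ℝ}
    (hH : Measurable H) (a : Fin 0 → ℕ) :
    campbellMoment lam μ c K u H a = ∫ ξ, H ξ ∂μ := by
  have hmap : (campbell lam μ c K 0).map Prod.snd = μ := by
    refine Measure.ext_of_lintegral _ fun h hh => ?_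
    rw [lintegral_map hh measurable_snd, lintegral_campbell_zero hc hh]
  have h := integral_map_of_stronglyMeasurable (μ := campbell lam μ c K 0)
    measurable_snd hH.stronglyMeasurable
  rw [hmap] at h
  simp [h, campbellMoment]

theorem map_card_blockOf {n : ℕ} (P : Finpartition (univ : Finset (Fin n))) :
    (univ : Finset (Fin P.parts.card)).val.map (fun l => (blockOf P l).card)
      = P.parts.val.map Finset.card := by
  have h := congrArg Finset.val (Finset.map_univ_equiv P.parts.equivFin.symm)
  rw [Finset.map_val, Finset.univ_eq_attach, Finset.attach_val] at h
  rw [← Multiset.attach_map_val P.parts.val, ← h, Multiset.map_map, Multiset.map_map]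
  rfl

theorem sum_campbellMoment (hc : Measurable (Function.uncurry c))
    (hGNZ : IsPapangelou lam μ c) (hK : MeasurableSet K) (hfin : ∀ᵐ ξ ∂μ, ξ K < ∞)
    (hu : Measurable (Function.uncurry u)) (hD : ∀ x ξ, |u x ξ| ≤ D) {n : ℕ}
    {H : Measure E → ℝ} (hH : MomentBound μ K H n) :
    ∑ P : Finpartition (univ : Finset (Fin n)),
        campbellMoment lam μ c K u H (fun l => (blockOf P l).card)
      = ∫ ξ, H ξ * powerIntegral hK u 1 ξ ^ n ∂μ := by
  have hsys := isMomentSystem_campbellMoment hc hGNZ hK hfin hu hD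
  have hiter : ∀ (m : ℕ) (H : Measure E → ℝ),
      (fun (H : Measure E → ℝ) ξ => H ξ * powerIntegral hK u 1 ξ)^[m] H
        = fun ξ => H ξ * powerIntegral hK u 1 ξ ^ m := by
    intro m
    induction m with
    | zero => intro H; simp
    | succ m ih =>
      intro H
      rw [Function.iterate_succ_apply, ih]
      ext ξ
      rw [pow_succ']
      ring
  have hmeas : Measurable fun ξ => H ξ * powerIntegral hK u 1 ξ ^ n :=
    hH.1.mul ((measurable_powerIntegral hK hu 1).pow_const n)
  have hbound : MomentBound μ K (fun ξ => H ξ * powerIntegral hK u 1 ξ ^ n) 0 :=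
    (show MomentBound μ K H (0 + n) by simpa using hH).mul_powerIntegral_pow hK hu hD
  have hsum := hsys.sum_finpartition (univ : Finset (Fin n)) (by simpa using hH)
  rw [Finset.card_univ, Fintype.card_fin, hiter] at hsum
  rw [← campbellMoment_zero (lam := lam) (K := K) (u := u) hc hmeas ![],
    hsys.moment_eq_blockMoment hbound]
  refine Eq.trans (Finset.sum_congr rfl fun P _ => ?_) (hsum.trans rfl)
  rw [hsys.moment_eq_blockMoment (hH.mono ?_), map_card_blockOf]
  simpa using P.card_parts_le_card

theorem lintegral_chat_lt_top (hc : Measurable (Function.uncurry c))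
    (hGNZ : IsPapangelou lam μ c) (hK : MeasurableSet K) (hfin : ∀ᵐ ξ ∂μ, ξ K < ∞) {k : ℕ}
    (hk : ∫⁻ ξ, (ξ K) ^ k ∂μ < ∞) :
    ∫⁻ p, chat c p.1 p.2 ∂((Measure.pi fun _ : Fin k => lam.restrict K).prod μ) < ∞ := by
  have h := lintegral_campbell_le hc hGNZ hK hfin k (measurable_const (a := (1 : ℝ≥0∞)))
  rw [lintegral_campbell hc measurable_const] at h
  rw [lintegral_prod_symm' _ (measurable_chat hc k)]
  simpa using h.trans_lt (by simpa using hk)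

theorem campbellMoment_eq_integral (hc : Measurable (Function.uncurry c))
    (hGNZ : IsPapangelou lam μ c) (hK : MeasurableSet K) (hfin : ∀ᵐ ξ ∂μ, ξ K < ∞)
    (hu : Measurable (Function.uncurry u)) (hD : ∀ x ξ, |u x ξ| ≤ D)
    (husupp : ∀ x ξ, x ∉ K → u x ξ = 0) {k : ℕ} (hk : ∫⁻ ξ, (ξ K) ^ k ∂μ < ∞)
    {H : Measure E → ℝ} (hH : MomentBound μ K H k) {a : Fin k → ℕ} (ha : ∀ l, a l ≠ 0) :
    campbellMoment lam μ c K u H a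
      = ∫ ξ, ∫ x : Fin k → E, (chat c x ξ).toReal *
          ((∏ l, u (x l) (ξ + ∑ j, Measure.dirac (x j)) ^ a l)
            * H (ξ + ∑ j, Measure.dirac (x j))) ∂(Measure.pi fun _ => lam) ∂μ := by
  have hg := measurable_momentIntegrand hu hH.1 a
  have hchat : ∀ᵐ p ∂((Measure.pi fun _ : Fin k => lam.restrict K).prod μ),
      chat c p.1 p.2 < ∞ :=
    ae_lt_top (measurable_chat hc k) (lintegral_chat_lt_top hc hGNZ hK hfin hk).ne
  have hint := hH.integrable hc hGNZ hK hfin hu hD a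
  rw [campbell, integrable_map_measure hg.aestronglyMeasurable (measurable_shift k).aemeasurable,
    integrable_withDensity_iff_integrable_smul' (measurable_chat hc k) hchat] at hint
  rw [campbellMoment, campbell, integral_map (measurable_shift k).aemeasurable
    hg.aestronglyMeasurable, integral_withDensity_eq_integral_toReal_smul (measurable_chat hc k)
    hchat]
  refine (integral_prod_symm _ hint).trans ?_
  refine integral_congr_ae (.of_forall fun ξ => ?_)
  dsimp only
  rw [← Measure.restrict_pi_pi]
  refine setIntegral_eq_integral_of_forall_compl_eq_zero fun x hx => ?_
  obtain ⟨l, hl⟩ : ∃ l, x l ∉ K := by simpa [Set.mem_pi] using hx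
  rw [Function.comp_apply]
  dsimp only
  rw [Finset.prod_eq_zero (mem_univ l) (by rw [husupp _ _ hl, zero_pow (ha l)])]
  simp

theorem compInt_eq {lam : Measure E} (hK : MeasurableSet K) (husupp : ∀ x ξ, x ∉ K → u x ξ = 0)
    {ξ : Measure E}
    (hξ : ξ K < ∞) : compInt lam c u ξ = powerIntegral hK u 1 ξ - compensator lam c u ξ := by
  rw [compInt, powerIntegral, restrictKernel_of_lt_top hK hξ]
  simp_rw [pow_one]
  rw [setIntegral_eq_integral_of_forall_compl_eq_zero fun x hx => husupp x ξ hx]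
  rfl

theorem card_blockOf_ne_zero {n : ℕ} (P : Finpartition (univ : Finset (Fin n)))
    (l : Fin P.parts.card) : (blockOf P l).card ≠ 0 :=
  (Finset.card_pos.2 (P.nonempty_of_mem_parts (P.parts.equivFin.symm l).2)).ne'

end Papangelou

/-- Moment formula for the compensated integral (Proposition 4.2). -/
theorem compensated_moment_formula
    {E : Type*} [MeasurableSpace E] (lam : Measure E) [SigmaFinite lam]
    (μ : Measure (Measure E)) [IsProbabilityMeasure μ]
    (c : E → Measure E → ENNReal) (hc : Measurable (Function.uncurry c))
    (hGNZ : ∀ w : E → Measure E → ENNReal, Measurable (Function.uncurry w) →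
      ∫⁻ ξ, (∫⁻ x, w x ξ ∂ξ) ∂μ
        = ∫⁻ ξ, ∫⁻ x, w x (ξ + Measure.dirac x) * c x ξ ∂lam ∂μ)
    (n : ℕ)
    (K : Set E) (hK : MeasurableSet K)
    (u : E → Measure E → ℝ) (hu : Measurable (Function.uncurry u))
    (Cu : ℝ) (hubd : ∀ x ξ, |u x ξ| ≤ Cu)
    (husupp : ∀ x ξ, x ∉ K → u x ξ = 0)
    (hmom : ∀ m ≤ n, (∫⁻ ξ, (ξ K) ^ m ∂μ) < ⊤)
    (hmomc : ∀ m ≤ n, (∫⁻ ξ, (∫⁻ z in K, c z ξ ∂lam) ^ m ∂μ) < ⊤)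
    (hRHSfin : ∀ i ∈ Finset.range (n + 1),
      ∀ P : Finpartition (Finset.univ : Finset (Fin (n - i))),
      (∫⁻ ξ, ∫⁻ x : Fin P.parts.card → E,
        chat c x ξ *
          (∏ l : Fin P.parts.card,
            (‖u (x l) (ξ + ∑ l', Measure.dirac (x l'))‖₊ : ENNReal) ^ (blockOf P l).card) *
          (∫⁻ z, (‖u z (ξ + ∑ l', Measure.dirac (x l'))‖₊ : ENNReal) *
            c z (ξ + ∑ l', Measure.dirac (x l')) ∂lam) ^ i
        ∂(Measure.pi fun _ => lam) ∂μ) < ⊤)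
    (F : Measure E → ℝ) (hF : Measurable F) (CF : ℝ) (hFbd : ∀ ξ, |F ξ| ≤ CF) :
    ∫ ξ, F ξ * (compInt lam c u ξ) ^ n ∂μ =
      ∑ i ∈ Finset.range (n + 1), (-1 : ℝ) ^ i * (n.choose i : ℝ) *
        (if i = n then
          ∫ ξ, F ξ * (∫ z, u z ξ * (c z ξ).toReal ∂lam) ^ n ∂μ
        else
          ∑ k ∈ Finset.Icc 1 (n - i),
            ∑ P ∈ Finset.univ.filter
                (fun P : Finpartition (Finset.univ : Finset (Fin (n - i))) =>
                  P.parts.card = k),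
              ∫ ξ, ∫ x : Fin P.parts.card → E,
                (chat c x ξ).toReal * F (ξ + ∑ l', Measure.dirac (x l')) *
                  (∏ l : Fin P.parts.card,
                    u (x l) (ξ + ∑ l', Measure.dirac (x l')) ^ (blockOf P l).card) *
                  (∫ z, u z (ξ + ∑ l', Measure.dirac (x l')) *
                    (c z (ξ + ∑ l', Measure.dirac (x l'))).toReal ∂lam) ^ i
                ∂(Measure.pi fun _ => lam) ∂μ) := by
  rcases Nat.eq_zero_or_pos n with rfl | hn
  · simp
  have hfin : ∀ᵐ ξ ∂μ, ξ K < ⊤ := by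
    refine ae_lt_top (Measure.measurable_coe hK) ?_
    simpa using (hmom 1 hn).ne
  have hbound : ∀ i ≤ n, Papangelou.MomentBound μ K
      (fun ξ => F ξ * Papangelou.compensator lam c u ξ ^ i) (n - i) := fun i hi =>
    Papangelou.momentBound_mul_compensator_pow hc hK hu hubd husupp hi (hmom n le_rfl)
      (hmomc n le_rfl) hF hFbd
  have hexpand : ∀ᵐ ξ ∂μ, F ξ * compInt lam c u ξ ^ n = ∑ i ∈ Finset.range (n + 1),
      (-1 : ℝ) ^ i * (n.choose i : ℝ) * (F ξ * Papangelou.compensator lam c u ξ ^ i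
        * Papangelou.powerIntegral hK u 1 ξ ^ (n - i)) := by
    filter_upwards [hfin] with ξ hξ
    rw [Papangelou.compInt_eq hK husupp hξ, sub_eq_neg_add, add_pow, Finset.mul_sum]
    refine Finset.sum_congr rfl fun i _ => ?_
    rw [neg_pow]
    ring
  rw [integral_congr_ae hexpand, integral_finsetSum]
  · refine Finset.sum_congr rfl fun i hi => ?_
    have hin : i ≤ n := Nat.lt_succ_iff.1 (Finset.mem_range.1 hi)
    rw [integral_const_mul]
    congr 1
    split_ifs with h
    · subst h
      simp [Papangelou.compensator]
    · rw [← Papangelou.sum_campbellMoment hc hGNZ hK hfin hu hubd (hbound i hin)]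
      rw [← Finset.sum_fiberwise_of_maps_to (s := univ) (t := Finset.Icc 1 (n - i))
        (g := fun P : Finpartition (Finset.univ : Finset (Fin (n - i))) => P.parts.card)]
      · refine Finset.sum_congr rfl fun k hk => Finset.sum_congr rfl fun P hP => ?_
        have hPk : P.parts.card ≤ n - i := by simpa using P.card_parts_le_card
        rw [Papangelou.campbellMoment_eq_integral hc hGNZ hK hfin hu hubd husupp
          (hmom _ (by omega)) ((hbound i hin).mono hPk) (Papangelou.card_blockOf_ne_zero P)]
        refine integral_congr_ae (.of_forall fun ξ => integral_congr_ae (.of_forall fun x => ?_))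
        simp only [Papangelou.compensator]
        ring
      · intro P _
        refine Finset.mem_Icc.2 ⟨Finset.card_pos.2 ?_, by simpa using P.card_parts_le_card⟩
        refine P.parts_nonempty ?_
        have : NeZero (n - i) := ⟨by omega⟩
        exact Finset.univ_nonempty.ne_empty
  · intro i hi
    have hin : i ≤ n := Nat.lt_succ_iff.1 (Finset.mem_range.1 hi)
    refine Integrable.const_mul ?_ _
    exact (Papangelou.MomentBound.mul_powerIntegral_pow hK hu hubd (k := 0)
      (by simpa using hbound i hin)).integrable_zero
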